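/- Let G be a finite group whose order is of the form 2n with n odd, 15 dividing n... Specifically: let Γ be a solvable nonabelian group of order 60 that is not isomorphic to A_5. Then Γ is isomorphic to A_4 × Z_5, or to a semidirect product Z_15 ⋊ Z_4, or to a semidirect product Z_15 ⋊ (Z_2 × Z_2). Moreover, in the latter two cases Γ has a unique subgroup of order 15. -/

import Mathlib

theorem fact_aux {p m : ℕ} (hp : p.Prime) (hm : ¬ p ∣ m) : (p * m).factorization p = 1 := by
  have h0 : m ≠ 0 := by rintro rfl; exact hm (dvd_zero _)
  rw [Nat.factorization_mul hp.ne_zero h0]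
  simp [hp.factorization_self, Nat.factorization_eq_zero_of_not_dvd hm]

theorem sylow_card_aux {G : Type*} [Group G] [Finite G] {p m : ℕ} [hp : Fact p.Prime]
    (hm : ¬ p ∣ m) (h : Nat.card G = p * m) (P : Sylow p G) :
    Nat.card P = p ∧ (P : Subgroup G).index = m := by
  have h1 : Nat.card P = p := by
    rw [P.card_eq_multiplicity, h, fact_aux hp.out hm, pow_one]
  refine ⟨h1, ?_⟩
  have h2 := (P : Subgroup G).card_mul_index
  rw [h] at h2
  have h3 : Nat.card (P : Subgroup G) = p := h1
  rw [h3] at h2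
  exact Nat.eq_of_mul_eq_mul_left hp.out.pos h2

/-- If `N` is normal and contains a normal Sylow subgroup of prime order, so does `G`. -/
theorem normal_up {G : Type*} [Group G] [Finite G] (N : Subgroup G) [N.Normal] {p m : ℕ}
    [hp : Fact p.Prime] (hm : ¬ p ∣ m) (h : Nat.card N = p * m)
    (hQ : ∃ Q : Subgroup N, Q.Normal ∧ Nat.card Q = p) :
    ∃ Q : Subgroup G, Q.Normal ∧ Nat.card Q = p := by
  obtain ⟨Q, hn, hc⟩ := hQ
  let P : Sylow p N := Sylow.ofCard Q (by rw [h, fact_aux hp.out hm, pow_one, hc])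
  have : Q.Characteristic := Sylow.characteristic_of_normal P hn
  refine ⟨Q.map N.subtype, inferInstance, ?_⟩
  rw [← hc]
  exact (Nat.card_congr (Q.equivMapOfInjective _ N.subtype_injective).toEquiv).symm

/-- A divisibility criterion for a normal Sylow subgroup. -/
theorem normal_sylow {G : Type*} [Group G] [Finite G] {p m : ℕ} [hp : Fact p.Prime]
    (hm : ¬ p ∣ m) (h : Nat.card G = p * m) (hd : ∀ n, n ∣ m → n ≡ 1 [MOD p] → n = 1) :
    ∃ Q : Subgroup G, Q.Normal ∧ Nat.card Q = p := by
  obtain ⟨P⟩ : Nonempty (Sylow p G) := inferInstance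
  obtain ⟨h1, h2⟩ := sylow_card_aux hm h P
  have h3 := hd _ (h2 ▸ P.card_dvd_index) (card_sylow_modEq_one p G)
  have : Subsingleton (Sylow p G) := (Nat.card_eq_one_iff_unique.mp h3).1
  exact ⟨P, Sylow.normal_of_subsingleton P, h1⟩

theorem normal_sylow_le {G : Type*} [Group G] [Finite G] {p m : ℕ} [hp : Fact p.Prime]
    (hm : ¬ p ∣ m) (h : Nat.card G = p * m) (hd : m ≤ p) :
    ∃ Q : Subgroup G, Q.Normal ∧ Nat.card Q = p := by
  refine normal_sylow hm h fun n hn h1 => ?_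
  have h0 : m ≠ 0 := by rintro rfl; exact hm (dvd_zero _)
  have h2 := Nat.le_of_dvd (Nat.pos_of_ne_zero h0) hn
  have h3 : n ≠ p := by rintro rfl; exact hm hn
  have := hp.out.one_lt
  unfold Nat.ModEq at h1
  rwa [Nat.mod_eq_of_lt (by omega), Nat.mod_eq_of_lt this] at h1

section Helpers

local instance fact_prime_five_aux : Fact (Nat.Prime 5) := ⟨by norm_num⟩

/-- Pull back a normal subgroup of a quotient. -/
theorem pull_back {G : Type*} [Group G] [Finite G] (N : Subgroup G) [N.Normal] {a b : ℕ}
    (ha : Nat.card N = a) (h : ∃ Q : Subgroup (G ⧸ N), Q.Normal ∧ Nat.card Q = b) :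
    ∃ Q : Subgroup G, Q.Normal ∧ Nat.card Q = a * b := by
  obtain ⟨Q, hn, hc⟩ := h
  refine ⟨Q.comap (QuotientGroup.mk' N), inferInstance, ?_⟩
  have h1 := (Q.comap (QuotientGroup.mk' N)).card_mul_index
  rw [Subgroup.index_comap_of_surjective _ (QuotientGroup.mk'_surjective N)] at h1
  have h2 := Q.card_mul_index
  have h3 := N.card_mul_index
  have h4 : Nat.card (G ⧸ N) = N.index := rfl
  have h5 : Q.index ≠ 0 := Subgroup.index_ne_zero_of_finite
  apply Nat.eq_of_mul_eq_mul_right (Nat.pos_of_ne_zero h5)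
  rw [h1, ← h3, ha, ← h4, ← h2, hc, mul_assoc]

theorem exists_prime_index {G : Type*} [Group G] [Finite G] [Nontrivial G] [Group.IsSolvable G] :
    ∃ M : Subgroup G, M.Normal ∧ M.index.Prime := by
  rcases eq_top_or_exists_le_coatom (commutator G) with h | ⟨M, hM, hle⟩
  · exact absurd h (Group.IsSolvable.commutator_lt_top_of_nontrivial G).ne
  have hn : M.Normal := Subgroup.Normal.of_commutator_le G hle
  refine ⟨M, hn, ?_⟩
  have hnt : Nontrivial (G ⧸ M) := QuotientGroup.nontrivial_iff.mpr hM.1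
  have hs : IsSimpleGroup (G ⧸ M) := by
    refine ⟨fun H _ => ?_⟩
    have hle : M ≤ H.comap (QuotientGroup.mk' M) := by
      intro x hx
      have : QuotientGroup.mk' M x = 1 := (QuotientGroup.eq_one_iff x).mpr hx
      rw [Subgroup.mem_comap, this]
      exact H.one_mem
    have hsurj := QuotientGroup.mk'_surjective M
    rw [← Subgroup.map_comap_eq_self_of_surjective hsurj H]
    rcases hM.le_iff.mp hle with h | h
    · right
      rw [h, Subgroup.map_top_of_surjective _ hsurj]
    · left
      rw [h, Subgroup.map_eq_bot_iff, QuotientGroup.ker_mk']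
  have hc : ∀ a b : G ⧸ M, a * b = b * a := IsSimpleGroup.comm_iff_isSolvable.mpr inferInstance
  letI : CommGroup (G ⧸ M) := { (inferInstance : Group (G ⧸ M)) with mul_comm := hc }
  exact IsSimpleGroup.prime_card (α := G ⧸ M)

theorem normal5_of_fifteen {G : Type*} [Group G] [Finite G] (h : Nat.card G = 15) :
    ∃ Q : Subgroup G, Q.Normal ∧ Nat.card Q = 5 :=
  normal_sylow_le (m := 3) (by norm_num) (by rw [h]) (by norm_num)

theorem normal5_of_thirty {G : Type*} [Group G] [Finite G] (h : Nat.card G = 30) :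
    ∃ Q : Subgroup G, Q.Normal ∧ Nat.card Q = 5 := by
  obtain ⟨P⟩ : Nonempty (Sylow 2 G) := inferInstance
  obtain ⟨h1, h2⟩ := sylow_card_aux (m := 15) (by norm_num) (by rw [h]) P
  have hc : IsCyclic P := isCyclic_of_prime_card h1
  have hcompl := IsCyclic.isComplement' (P := P) (by rw [h]; norm_num) hc
  have h3 := hcompl.card_mul_card
  have h1' : Nat.card (P : Subgroup G) = 2 := h1
  rw [h1'] at h3
  replace h3 := h3.trans h
  have h4 : Nat.card (MonoidHom.transferSylow P
    (hc.normalizer_le_centralizer (by rw [h]; norm_num))).ker = 15 := by omega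
  exact normal_up _ (m := 3) (by norm_num) h4 (normal5_of_fifteen h4)

theorem twelve {H : Type*} [Group H] [Finite H] (h : Nat.card H = 12) :
    (∃ Q : Subgroup H, Q.Normal ∧ Nat.card Q = 3) ∨
    (Nat.card (Sylow 3 H) = 4 ∧
      Function.Injective (MulAction.toPermHom H (Sylow 3 H))) := by
  by_cases hq : ∃ Q : Subgroup H, Q.Normal ∧ Nat.card Q = 3
  · exact Or.inl hq
  right
  obtain ⟨P⟩ : Nonempty (Sylow 3 H) := inferInstance
  obtain ⟨h1, h2⟩ := sylow_card_aux (m := 4) (by norm_num) (by rw [h]) P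
  have h1' : Nat.card (P : Subgroup H) = 3 := h1
  have h3 : Nat.card (Sylow 3 H) ∣ 4 := h2 ▸ P.card_dvd_index
  have h4 := card_sylow_modEq_one 3 H
  have h5 : Nat.card (Sylow 3 H) = 4 := by
    have h6 := Nat.le_of_dvd (by norm_num) h3
    have h7 : Nat.card (Sylow 3 H) ≠ 1 := by
      intro h8
      have : Subsingleton (Sylow 3 H) := (Nat.card_eq_one_iff_unique.mp h8).1
      exact hq ⟨P, Sylow.normal_of_subsingleton P, h1⟩
    unfold Nat.ModEq at h4
    omega
  refine ⟨h5, ?_⟩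
  rw [← MonoidHom.ker_eq_bot_iff]
  set K := (MulAction.toPermHom H (Sylow 3 H)).ker with hK
  have hnorm : Subgroup.normalizer (P : Set H) = P := by
    have h8 : (Subgroup.normalizer (P : Set H)).index = 4 := by
      rw [← h5]; exact P.card_eq_index_normalizer.symm
    have h9 := (Subgroup.normalizer (P : Set H)).card_mul_index
    symm
    apply Subgroup.eq_of_le_of_card_ge (Subgroup.le_normalizer (H := (P : Subgroup H)))
    rw [h8, h] at h9
    rw [h1']
    have h10 : Nat.card (Subgroup.normalizer (P : Set H)) = 3 := by omega
    exact h10.le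
  have hle : K ≤ P := by
    intro x hx
    rw [← hnorm]
    rw [← Sylow.smul_eq_iff_mem_normalizer]
    have := MonoidHom.mem_ker.mp hx
    exact congrArg (fun f : Equiv.Perm (Sylow 3 H) => f P) this
  have hd := Subgroup.card_dvd_of_le hle
  rw [h1'] at hd
  rcases (Nat.dvd_prime Nat.prime_three).mp hd with h6 | h6
  · exact Subgroup.card_eq_one.mp h6
  · exact absurd ⟨K, inferInstance, h6⟩ hq

theorem alt_of_inj {H : Type*} [Group H] [Finite H] (h : Nat.card H = 12)
    (h4 : Nat.card (Sylow 3 H) = 4)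
    (hinj : Function.Injective (MulAction.toPermHom H (Sylow 3 H))) :
    Nonempty (H ≃* alternatingGroup (Fin 4)) := by
  have e : Sylow 3 H ≃ Fin 4 := Finite.equivFinOfCardEq h4
  let f : H →* Equiv.Perm (Fin 4) :=
    (e.permCongrHom : Equiv.Perm (Sylow 3 H) →* Equiv.Perm (Fin 4)).comp
      (MulAction.toPermHom H (Sylow 3 H))
  have hf : Function.Injective f := e.permCongrHom.injective.comp hinj
  have e1 : H ≃* f.range := MonoidHom.ofInjective hf
  have hidx : f.range.index = 2 := by
    have h1 := f.range.card_mul_index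
    rw [← Nat.card_congr e1.toEquiv, h, Nat.card_perm, Nat.card_eq_fintype_card,
      Fintype.card_fin] at h1
    norm_num [Nat.factorial] at h1
    omega
  have := Equiv.Perm.eq_alternatingGroup_of_index_eq_two hidx
  exact ⟨e1.trans (MulEquiv.subgroupCongr this)⟩

theorem normal5_of_index5 {G : Type*} [Group G] [Finite G] (h : Nat.card G = 60)
    (N : Subgroup G) [N.Normal] (hN : Nat.card N = 12) (hi : N.index = 5) :
    ∃ Q : Subgroup G, Q.Normal ∧ Nat.card Q = 5 := by
  rcases twelve hN with hq | ⟨h4, hinj⟩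
  · obtain ⟨Q, hQn, hQ⟩ := normal_up N (m := 4) (by norm_num) (by rw [hN]) hq
    have h1 := Q.card_mul_index
    rw [hQ, h] at h1
    have h2 : Nat.card (G ⧸ Q) = 20 := by change Q.index = 20; omega
    obtain ⟨R, hRn, hR⟩ := pull_back Q hQ
      (normal_sylow_le (p := 5) (m := 4) (by norm_num) (by rw [h2]) (by norm_num))
    exact normal_up R (m := 3) (by norm_num) hR (normal5_of_fifteen hR)
  · let f : G →* Equiv.Perm (Sylow 3 N) :=
      (MulAction.toPermHom (MulAut N) (Sylow 3 N)).comp MulAut.conjNormal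
    refine ⟨f.ker, inferInstance, ?_⟩
    have hdisj : f.ker ⊓ N = ⊥ := by
      rw [eq_bot_iff]
      rintro x ⟨hx, hxN⟩
      have h1 : MulAction.toPermHom N (Sylow 3 N) ⟨x, hxN⟩ = 1 := by
        have hx' : f x = 1 := hx
        rw [← hx']
        have : MulAut.conjNormal (H := N) x = MulAut.conj (⟨x, hxN⟩ : N) := by
          ext y; simp
        ext1 P
        change (⟨x, hxN⟩ : N) • P = MulAut.conjNormal (H := N) x • P
        rw [this, Sylow.smul_def]
      have h2 := hinj (h1.trans (map_one _).symm)
      exact Subgroup.mem_bot.mpr (congrArg Subtype.val h2)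
    have hd5 : Nat.card f.ker ∣ 5 := by
      have h1 : Function.Injective ((QuotientGroup.mk' N).comp f.ker.subtype) := by
        rw [injective_iff_map_eq_one]
        rintro ⟨a, ha⟩ h2
        have h3 : a ∈ N := (QuotientGroup.eq_one_iff a).mp h2
        have h4 : a ∈ f.ker ⊓ N := ⟨ha, h3⟩
        rw [hdisj] at h4
        exact Subtype.ext (Subgroup.mem_bot.mp h4)
      have h2 := Subgroup.card_dvd_of_injective _ h1
      rwa [show Nat.card (G ⧸ N) = 5 from hi] at h2
    rcases (Nat.dvd_prime (by norm_num)).mp hd5 with h1 | h1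
    · exfalso
      have h2 : f.ker = ⊥ := Subgroup.card_eq_one.mp h1
      have h3 := Subgroup.card_dvd_of_injective f ((MonoidHom.ker_eq_bot_iff f).mp h2)
      rw [h, Nat.card_perm, h4] at h3
      norm_num [Nat.factorial] at h3
    · exact h1

theorem normal5 {G : Type*} [Group G] [Finite G] (h : Nat.card G = 60) (hs : Group.IsSolvable G) :
    ∃ Q : Subgroup G, Q.Normal ∧ Nat.card Q = 5 := by
  have : Nontrivial G := Finite.one_lt_card_iff_nontrivial.mp (by omega)
  obtain ⟨M, hM, hp⟩ := exists_prime_index (G := G)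
  have h1 := M.card_mul_index
  rw [h] at h1
  have h2 : M.index ∣ 2 * 2 * 3 * 5 := ⟨Nat.card M, by rw [mul_comm M.index, h1]⟩
  have h3 : M.index = 2 ∨ M.index = 3 ∨ M.index = 5 := by
    have hle := hp.dvd_mul.mp h2
    rw [hp.dvd_mul, hp.dvd_mul, Nat.prime_dvd_prime_iff_eq hp Nat.prime_two,
      Nat.prime_dvd_prime_iff_eq hp Nat.prime_three,
      Nat.prime_dvd_prime_iff_eq hp Nat.prime_five] at hle
    tauto
  rcases h3 with h3 | h3 | h3 <;> rw [h3] at h1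
  · have h4 : Nat.card M = 30 := by omega
    exact normal_up M (m := 6) (by norm_num) h4 (normal5_of_thirty h4)
  · have h4 : Nat.card M = 20 := by omega
    exact normal_up M (m := 4) (by norm_num) h4
      (normal_sylow_le (m := 4) (by norm_num) (by rw [h4]) (by norm_num))
  · exact normal5_of_index5 h M (by omega) h3

theorem cyclic15 {G : Type*} [Group G] [Finite G] (h : Nat.card G = 15) : IsCyclic G := by
  obtain ⟨P, hPn, hP⟩ := normal5_of_fifteen h
  obtain ⟨Q, hQn, hQ⟩ : ∃ Q : Subgroup G, Q.Normal ∧ Nat.card Q = 3 := by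
    refine normal_sylow (m := 5) (by norm_num) (by rw [h]) fun n hn h1 => ?_
    rcases (Nat.dvd_prime (by norm_num)).mp hn with rfl | rfl
    · rfl
    · exact absurd h1 (by decide)
  have hc1 : IsCyclic P := isCyclic_of_prime_card hP
  have hc2 : IsCyclic Q := isCyclic_of_prime_card hQ
  obtain ⟨x, hx⟩ := IsCyclic.exists_ofOrder_eq_natCard (α := P)
  obtain ⟨y, hy⟩ := IsCyclic.exists_ofOrder_eq_natCard (α := Q)
  rw [hP] at hx
  rw [hQ] at hy
  have hd : Disjoint P Q := by
    exact Subgroup.disjoint_of_coprime_natCard (by rw [hP, hQ]; norm_num)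
  have hcomm : Commute (x : G) (y : G) :=
    Subgroup.commute_of_normal_of_disjoint P Q hPn hQn hd x y x.2 y.2
  have ho := hcomm.orderOf_mul_eq_mul_orderOf_of_coprime
    (by rw [Subgroup.orderOf_coe, Subgroup.orderOf_coe, hx, hy]; norm_num)
  rw [Subgroup.orderOf_coe, Subgroup.orderOf_coe, hx, hy] at ho
  exact isCyclic_of_orderOf_eq_card _ (by rw [ho, h])

theorem order_four {G : Type*} [Group G] [Finite G] (h : Nat.card G = 4) :
    Nonempty (G ≃* Multiplicative (ZMod 4)) ∨
    Nonempty (G ≃* Multiplicative (ZMod 2) × Multiplicative (ZMod 2)) := by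
  by_cases hc : IsCyclic G
  · left
    exact ⟨mulEquivOfCyclicCardEq (by rw [h]; simp)⟩
  · right
    have hk : IsKleinFour G := by
      refine ⟨h, ?_⟩
      have hx : ∀ g : G, g ^ 2 = 1 := by
        intro g
        have h1 : orderOf g ∣ 2 ^ 2 := by
          have := orderOf_dvd_natCard g
          rwa [h] at this
        obtain ⟨k, hk, hk'⟩ := (Nat.dvd_prime_pow Nat.prime_two).mp h1
        have hk2 : k ≠ 2 := by
          rintro rfl
          exact hc (isCyclic_of_orderOf_eq_card g (by rw [hk', h]; norm_num))
        apply orderOf_dvd_iff_pow_eq_one.mp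
        rw [hk']
        exact pow_dvd_pow 2 (show k ≤ 1 by omega)
      have hd : Monoid.exponent G ∣ 2 := Monoid.exponent_dvd_of_forall_pow_eq_one hx
      rcases (Nat.dvd_prime Nat.prime_two).mp hd with h1 | h1
      · have := Monoid.exp_eq_one_iff.mp h1
        have := Nat.card_of_subsingleton (1 : G)
        omega
      · exact h1
    have hk2 : IsKleinFour (Multiplicative (ZMod 2) × Multiplicative (ZMod 2)) := by
      refine ⟨by simp, ?_⟩
      simp [Monoid.exponent_prod]
    exact IsKleinFour.nonempty_mulEquiv

theorem semidirect_of_normal15 {G : Type*} [Group G] [Finite G] (h : Nat.card G = 60)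
    (N : Subgroup G) [N.Normal] (hN : Nat.card N = 15) :
    (∃ φ : Multiplicative (ZMod 4) →* MulAut (Multiplicative (ZMod 15)),
        Nonempty (G ≃* Multiplicative (ZMod 15) ⋊[φ] Multiplicative (ZMod 4))) ∨
      (∃ φ : Multiplicative (ZMod 2) × Multiplicative (ZMod 2) →*
          MulAut (Multiplicative (ZMod 15)),
        Nonempty (G ≃* Multiplicative (ZMod 15) ⋊[φ]
          (Multiplicative (ZMod 2) × Multiplicative (ZMod 2)))) := by
  have hi := N.card_mul_index
  rw [hN, h] at hi
  have hi4 : N.index = 4 := by omega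
  obtain ⟨K, hK⟩ := Subgroup.exists_right_complement'_of_coprime (N := N)
    (by rw [hN, hi4]; norm_num)
  have hK4 : Nat.card K = 4 := by
    have := hK.card_mul_card
    rw [hN, h] at this
    omega
  have hc := cyclic15 hN
  have en : N ≃* Multiplicative (ZMod 15) := mulEquivOfCyclicCardEq (by rw [hN]; simp)
  have e := SemidirectProduct.mulEquivSubgroup hK
  rcases order_four hK4 with ek | ek <;> obtain ⟨ek⟩ := ek
  · left
    exact ⟨_, ⟨e.symm.trans (SemidirectProduct.congr' en ek)⟩⟩
  · right
    exact ⟨_, ⟨e.symm.trans (SemidirectProduct.congr' en ek)⟩⟩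

theorem alt_hom_trivial {M : Type*} [Group M] (hM : Nat.card M = 4)
    (f : alternatingGroup (Fin 4) →* M) (x : alternatingGroup (Fin 4)) : f x = 1 := by
  have hle : alternatingGroup (Fin 4) ≤ f.ker.map (alternatingGroup (Fin 4)).subtype := by
    conv_lhs => rw [← Equiv.Perm.closure_three_cycles_eq_alternating]
    rw [Subgroup.closure_le]
    intro σ hσ
    have hσ' : Equiv.Perm.IsThreeCycle σ := hσ
    refine ⟨⟨σ, hσ'.mem_alternatingGroup⟩, ?_, rfl⟩
    have h3 : (⟨σ, hσ'.mem_alternatingGroup⟩ : alternatingGroup (Fin 4)) ^ 3 = 1 := by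
      apply Subtype.ext
      have := pow_orderOf_eq_one σ
      rw [hσ'.orderOf] at this
      exact this
    have h4 := congrArg f h3
    rw [map_pow, map_one] at h4
    have h5 : orderOf (f ⟨σ, hσ'.mem_alternatingGroup⟩) ∣ 3 := orderOf_dvd_of_pow_eq_one h4
    have h6 : orderOf (f ⟨σ, hσ'.mem_alternatingGroup⟩) ∣ 4 :=
      (orderOf_dvd_natCard _).trans hM.dvd
    have h7 := Nat.dvd_gcd h5 h6
    norm_num at h7
    exact h7
  obtain ⟨y, hy, hxy⟩ := hle x.2
  have : y = x := Subtype.ext hxy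
  exact this ▸ hy

theorem alt_case {G : Type*} [Group G] [Finite G] (h : Nat.card G = 60)
    (P : Subgroup G) [P.Normal] (hP : Nat.card P = 5)
    (e : G ⧸ P ≃* alternatingGroup (Fin 4)) :
    Nonempty (G ≃* alternatingGroup (Fin 4) × Multiplicative (ZMod 5)) := by
  have hc : IsCyclic P := isCyclic_of_prime_card hP
  have hA : Nat.card (MulAut P) = 4 := by
    rw [IsCyclic.card_mulAut, hP]; decide
  have hcomm : ∀ a b : P, a * b = b * a := fun a b => mul_comm' a b
  let c : G →* MulAut P := MulAut.conjNormal
  have hker : P ≤ c.ker := by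
    intro x hx
    rw [MonoidHom.mem_ker]
    ext y
    have := congrArg Subtype.val (hcomm ⟨x, hx⟩ y)
    simp only [Subgroup.coe_mul] at this
    simp [c, this]
  let q : G ⧸ P →* MulAut P := QuotientGroup.lift P c hker
  have hq : ∀ x : G, c x = 1 := by
    intro x
    have h1 := alt_hom_trivial hA (q.comp e.symm.toMonoidHom) (e (QuotientGroup.mk' P x))
    simpa [q] using h1
  have hcen : ∀ (x : G) (y : P), x * y = y * x := by
    intro x y
    have h1 := congrArg (fun f : MulAut P => ((f y : P) : G)) (hq x)
    simp only [c, MulAut.conjNormal_apply, MulAut.one_apply] at h1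
    exact mul_inv_eq_iff_eq_mul.mp h1
  have hi := P.card_mul_index
  rw [hP, h] at hi
  have hi4 : P.index = 12 := by omega
  obtain ⟨K, hK⟩ := Subgroup.exists_right_complement'_of_coprime (N := P)
    (by rw [hP, hi4]; norm_num)
  have ek : K ≃* alternatingGroup (Fin 4) := hK.symm.QuotientMulEquiv.symm.trans e
  have ep : P ≃* Multiplicative (ZMod 5) := mulEquivOfCyclicCardEq (by rw [hP]; simp)
  let f : K × P →* G := MonoidHom.noncommCoprod K.subtype P.subtype (fun x y => hcen x y)
  have hf : Function.Bijective f := hK.symm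
  exact ⟨(MulEquiv.ofBijective f hf).symm.trans (ek.prodCongr ep)⟩

theorem unique15 {G : Type*} [Group G] [Finite G] (h : Nat.card G = 60)
    (N : Subgroup G) [N.Normal] (hN : Nat.card N = 15) :
    ∃! H : Subgroup G, Nat.card H = 15 := by
  refine ⟨N, hN, fun H hH => ?_⟩
  have hi := N.card_mul_index
  rw [hN, h] at hi
  have hi4 : Nat.card (G ⧸ N) = 4 := by change N.index = 4; omega
  have hle : H ≤ N := by
    intro x hx
    have h1 : (x : G ⧸ N) ^ 15 = 1 := by
      have h2 : (⟨x, hx⟩ : H) ^ 15 = 1 := hH ▸ pow_card_eq_one'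
      have h3 : x ^ 15 = 1 := congrArg Subtype.val h2
      rw [← QuotientGroup.mk_pow, h3, QuotientGroup.mk_one]
    have h5 : orderOf (x : G ⧸ N) ∣ 15 := orderOf_dvd_of_pow_eq_one h1
    have h6 : orderOf (x : G ⧸ N) ∣ 4 := hi4 ▸ orderOf_dvd_natCard _
    have h7 := Nat.dvd_gcd h5 h6
    norm_num at h7
    exact h7
  exact Subgroup.eq_of_le_of_card_ge hle (by rw [hN, hH])

theorem unique15_of_semidirect {G K : Type*} [Group G] [Finite G] [Group K]
    (h : Nat.card G = 60) (φ : K →* MulAut (Multiplicative (ZMod 15)))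
    (e : G ≃* Multiplicative (ZMod 15) ⋊[φ] K) :
    ∃! H : Subgroup G, Nat.card H = 15 := by
  let f : G →* K := SemidirectProduct.rightHom.comp e.toMonoidHom
  have hf : Function.Surjective f := SemidirectProduct.rightHom_surjective.comp e.surjective
  have h1 : Nat.card G = 15 * Nat.card K := by
    rw [Nat.card_congr e.toEquiv, SemidirectProduct.card]; simp
  have h2 := f.ker.card_mul_index
  rw [Subgroup.index_ker, MonoidHom.range_eq_top.mpr hf, Subgroup.card_top] at h2
  have h3 : Nat.card K = 4 := by omega
  rw [h3, h] at h2
  exact unique15 h f.ker (by omega)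


end Helpers

/-- A solvable nonabelian group `Γ` of order 60 (equivalently, a nonabelian
group of order 60 not isomorphic to `A_5`) is isomorphic to `A_4 × Z_5`, or to
a semidirect product `Z_15 ⋊ Z_4`, or to a semidirect product
`Z_15 ⋊ (Z_2 × Z_2)`. Moreover, in the latter two cases `Γ` has a unique
subgroup of order 15. -/
theorem solvable_nonabelian_order_sixty
    (Γ : Type*) [Group Γ] (hcard : Nat.card Γ = 60)
    (hsol : IsSolvable Γ) (hnab : ¬ ∀ a b : Γ, a * b = b * a) :
    (Nonempty (Γ ≃* alternatingGroup (Fin 4) × Multiplicative (ZMod 5)) ∨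
      (∃ φ : Multiplicative (ZMod 4) →* MulAut (Multiplicative (ZMod 15)),
        Nonempty (Γ ≃* Multiplicative (ZMod 15) ⋊[φ] Multiplicative (ZMod 4))) ∨
      (∃ φ : Multiplicative (ZMod 2) × Multiplicative (ZMod 2) →*
          MulAut (Multiplicative (ZMod 15)),
        Nonempty (Γ ≃* Multiplicative (ZMod 15) ⋊[φ]
          (Multiplicative (ZMod 2) × Multiplicative (ZMod 2))))) ∧
    (((∃ φ : Multiplicative (ZMod 4) →* MulAut (Multiplicative (ZMod 15)),
        Nonempty (Γ ≃* Multiplicative (ZMod 15) ⋊[φ] Multiplicative (ZMod 4))) ∨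
      (∃ φ : Multiplicative (ZMod 2) × Multiplicative (ZMod 2) →*
          MulAut (Multiplicative (ZMod 15)),
        Nonempty (Γ ≃* Multiplicative (ZMod 15) ⋊[φ]
          (Multiplicative (ZMod 2) × Multiplicative (ZMod 2))))) →
      ∃! H : Subgroup Γ, Nat.card H = 15) := by
  have hfin : Finite Γ := Nat.finite_of_card_ne_zero (by omega)
  constructor
  · obtain ⟨P, hPn, hP⟩ := normal5 hcard hsol
    have hi := P.card_mul_index
    rw [hP, hcard] at hi
    have h12 : Nat.card (Γ ⧸ P) = 12 := by change P.index = 12; omega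
    rcases twelve h12 with hq | ⟨h4, hinj⟩
    · right
      obtain ⟨N, hNn, hN⟩ := pull_back P hP hq
      exact semidirect_of_normal15 hcard N hN
    · left
      obtain ⟨e⟩ := alt_of_inj h12 h4 hinj
      exact alt_case hcard P hP e
  · rintro (⟨φ, ⟨e⟩⟩ | ⟨φ, ⟨e⟩⟩)
    · exact unique15_of_semidirect hcard φ e
    · exact unique15_of_semidirect hcard φ e
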